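/- arXiv:1804.11274 — 3 statements merged into one kernel-verified Lean document; each statement's English description precedes it below -/
import Mathlib

section
/- Let Λ be a poset equipped with the Alexandroff (upper set) topology and let π : X → Λ be a continuous surjective map from a topological space X. Then π is an open map if and only if for all μ, λ ∈ Λ one has: π⁻¹({μ}) ⊆ closure(π⁻¹({λ})) if and only if μ ≤ λ. -/
/-- Let `Λ` be a poset equipped with the Alexandroff (upper set) topology and
`π : X → Λ` a continuous surjective map from a topological space `X`. Then `π` is open
if and only if for all `μ, l ∈ Λ`: `π⁻¹{μ} ⊆ closure (π⁻¹{l})` iff `μ ≤ l`. -/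
theorem open_iff_stratum_closure_order {X Λ : Type*} [TopologicalSpace X] [PartialOrder Λ]
    (T : TopologicalSpace Λ)
    (halex : ∀ s : Set Λ, @IsOpen Λ T s ↔ IsUpperSet s)
    (π : X → Λ) (hcont : @Continuous X Λ _ T π) (hsurj : Function.Surjective π) :
    @IsOpenMap X Λ _ T π ↔
      ∀ μ l : Λ, (π ⁻¹' {μ} ⊆ closure (π ⁻¹' {l}) ↔ μ ≤ l) := by
  have le_of_subset : ∀ μ l : Λ, π ⁻¹' {μ} ⊆ closure (π ⁻¹' {l}) → μ ≤ l := by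
    intro μ l h
    obtain ⟨x, rfl⟩ := hsurj μ
    have hU : IsOpen (π ⁻¹' Set.Ici (π x)) :=
      hcont.isOpen_preimage _ ((halex _).2 (isUpperSet_Ici _))
    obtain ⟨y, hy, rfl⟩ := mem_closure_iff.1 (h rfl) _ hU le_rfl
    exact hy
  constructor
  · refine fun hopen μ l => ⟨le_of_subset μ l, ?_⟩
    rintro hle x rfl
    refine mem_closure_iff.2 fun U hU hx => ?_
    obtain ⟨y, hy, hyl⟩ := (halex _).1 (hopen U hU) hle (Set.mem_image_of_mem π hx)
    exact ⟨y, hy, hyl⟩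
  · refine fun h U hU => (halex _).2 ?_
    rintro _ b hab ⟨x, hx, rfl⟩
    obtain ⟨y, hy, hyb⟩ := mem_closure_iff.1 ((h (π x) b).2 hab rfl) U hU hx
    exact ⟨y, hy, hyb⟩
end

section
/- Let Λ be a poset equipped with the Alexandroff (upper set) topology and let π : X → Λ be a continuous, open, surjective map from a topological space X. Then π is normal: for all μ, λ ∈ Λ, if π⁻¹({μ}) ∩ closure(π⁻¹({λ})) ≠ ∅ then π⁻¹({μ}) ⊆ closure(π⁻¹({λ})). -/
/-- Let `Λ` be a poset with the Alexandroff (upper set) topology and `π : X → Λ` a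
continuous, open, surjective map. Then `π` is normal: if `π⁻¹{μ}` meets
`closure (π⁻¹{l})`, it is contained in it. -/
theorem normality_of_open_continuous_stratification {X Λ : Type*} [TopologicalSpace X]
    [PartialOrder Λ] (T : TopologicalSpace Λ)
    (halex : ∀ s : Set Λ, @IsOpen Λ T s ↔ IsUpperSet s)
    (π : X → Λ) (hcont : @Continuous X Λ _ T π) (hopen : @IsOpenMap X Λ _ T π)
    (hsurj : Function.Surjective π) :
    ∀ μ l : Λ, π ⁻¹' {μ} ∩ closure (π ⁻¹' {l}) ≠ ∅ →
      π ⁻¹' {μ} ⊆ closure (π ⁻¹' {l}) := by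
  intro μ l hne y hy
  obtain ⟨x, hxμ, hx⟩ := Set.nonempty_iff_ne_empty.mpr hne
  have hle : μ ≤ l := by
    have hIci : IsOpen (π ⁻¹' Set.Ici μ) :=
      hcont.isOpen_preimage _ ((halex _).mpr (isUpperSet_Ici μ))
    obtain ⟨z, hzμ, hzl⟩ := mem_closure_iff.mp hx _ hIci (Eq.ge hxμ)
    exact le_of_le_of_eq hzμ hzl
  refine mem_closure_iff.mpr fun U hU hyU => ?_
  obtain ⟨z, hzU, hzl⟩ := (halex _).mp (hopen U hU) hle ⟨y, hyU, hy⟩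
  exact ⟨z, hzU, hzl⟩
end

section
/- Let Λ be a poset equipped with the Alexandroff (upper set) topology and let π : X → Λ be a surjective map from a topological space X satisfying: (i) for all μ, λ ∈ Λ, π⁻¹({μ}) ⊆ closure(π⁻¹({λ})) if and only if μ ≤ λ; (ii) for all μ, λ ∈ Λ, if π⁻¹({μ}) ∩ closure(π⁻¹({λ})) ≠ ∅ then π⁻¹({μ}) ⊆ closure(π⁻¹({λ})); and (iii) for every closed subset C ⊆ Λ, the union ⋃_{λ ∈ C} closure(π⁻¹({λ})) is closed in X. Then π is continuous. -/
/-- Let `Λ` be a poset with the Alexandroff (upper set) topology and `π : X → Λ` a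
surjective map satisfying conditions (i), (ii), (iii). Then `π` is continuous. -/
theorem continuity_from_frontier_conditions {X Λ : Type*} [TopologicalSpace X]
    [PartialOrder Λ] (T : TopologicalSpace Λ)
    (halex : ∀ s : Set Λ, @IsOpen Λ T s ↔ IsUpperSet s)
    (π : X → Λ) (hsurj : Function.Surjective π)
    (h1 : ∀ μ l : Λ, π ⁻¹' {μ} ⊆ closure (π ⁻¹' {l}) ↔ μ ≤ l)
    (h2 : ∀ μ l : Λ, π ⁻¹' {μ} ∩ closure (π ⁻¹' {l}) ≠ ∅ →
      π ⁻¹' {μ} ⊆ closure (π ⁻¹' {l}))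
    (h3 : ∀ C : Set Λ, @IsClosed Λ T C → IsClosed (⋃ l ∈ C, closure (π ⁻¹' {l}))) :
    @Continuous X Λ _ T π := by
  refine continuous_iff_isClosed.2 fun C hC => ?_
  have hlower : IsLowerSet C := isUpperSet_compl.1 ((halex _).1 hC.isOpen_compl)
  have hpre : π ⁻¹' C = ⋃ l ∈ C, closure (π ⁻¹' {l}) := by
    ext x
    simp only [Set.mem_preimage, Set.mem_iUnion, exists_prop]
    constructor
    · exact fun hx => ⟨π x, hx, subset_closure rfl⟩
    · rintro ⟨l, hl, hx⟩
      have hne : (π ⁻¹' {π x} ∩ closure (π ⁻¹' {l})).Nonempty := ⟨x, rfl, hx⟩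
      exact hlower ((h1 _ _).1 (h2 _ _ hne.ne_empty)) hl
  rw [hpre]
  exact h3 C hC
end
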